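/- arXiv:1104.4972 — 2 statements merged into one kernel-verified Lean document; each statement's English description precedes it below -/
import Mathlib

section
/- The complex vector space Weyl = { (f_{ab}^A) : Π_{ab}^{A cd}{}_B f_{cd}^B = f_{ab}^A and f_{ab}^{&A} = 0 } has complex dimension 5. -/
/-- The antisymmetric epsilon symbol on `{0,1}` with `ε 0 1 = 1`. -/
def eps (a b : Fin 2) : ℂ := if a < b then 1 else if b < a then -1 else 0

/-- The Kronecker delta. -/
def kdelta (a b : Fin 2) : ℂ := if a = b then 1 else 0

/-- Capital index type: four coordinate indices plus quadruple spinor indices. -/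
abbrev Idx : Type := Fin 4 ⊕ (Fin 2 × Fin 2 × Fin 2 × Fin 2)

/-- Total symmetrizer of `k` spinor indices. -/
noncomputable def symk {k : ℕ} (up lo : Fin k → Fin 2) : ℂ :=
  (Nat.factorial k : ℂ)⁻¹ * ∑ π : Equiv.Perm (Fin k), ∏ i, kdelta (up i) (lo (π i))

/-- The projection `Π_{a₁…a_k}^{A b₁…b_k}{}_B`: zero if `A` or `B` is a coordinate index,
and otherwise given by
`Π_{a₁…a_k c₁c₂}^{c₃c₄ b₁…b_k d₁d₂}{}_{d₃d₄}
  = δ_{c₁}^{d₁} δ^{c₃}_{d₃} ε^{c₄e} ε_{d₄f} S^{b₁…b_k d₂ f}_{a₁…a_k c₂ e}`. -/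
noncomputable def PiProj {k : ℕ} (lo up : Fin k → Fin 2) (A B : Idx) : ℂ :=
  match A, B with
  | Sum.inr (c1, c2, c3, c4), Sum.inr (d1, d2, d3, d4) =>
      kdelta c1 d1 * kdelta c3 d3 *
        ∑ e : Fin 2, ∑ f : Fin 2, eps c4 e * eps d4 f *
          symk (Fin.snoc (Fin.snoc up d2) f) (Fin.snoc (Fin.snoc lo c2) e)
  | _, _ => 0

/-- The `♯` operation: swap the order within each spinor index pair. -/
def sharp : Idx → Idx
  | Sum.inl α => Sum.inl α
  | Sum.inr (i, j, k, l) => Sum.inr (j, i, l, k)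

/-- The `&` prefix: `f^{&A} = Π^A{}_B Π^{♯B}{}_{♯C} f^C`. -/
noncomputable def amp (f : Idx → ℂ) (A : Idx) : ℂ :=
  ∑ B : Idx, ∑ C : Idx,
    PiProj (k := 0) ![] ![] A B * PiProj (k := 0) ![] ![] (sharp B) (sharp C) * f C

/-- Membership in `Weyl`: `Π_{ab}^{Acd}{}_B f_{cd}^B = f_{ab}^A` and `f_{ab}^{&A} = 0`. -/
noncomputable def WeylMem (f : Fin 2 → Fin 2 → Idx → ℂ) : Prop :=
  (∀ (a b : Fin 2) (A : Idx),
    (∑ c : Fin 2, ∑ d : Fin 2, ∑ B : Idx, PiProj ![a, b] ![c, d] A B * f c d B) = f a b A) ∧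
  (∀ (a b : Fin 2) (A : Idx), amp (f a b) A = 0)


/-- All permutations of four elements, listed by their values. -/
def perms4 : List (Fin 4 × Fin 4 × Fin 4 × Fin 4) :=
  [(0, 1, 2, 3), (0, 1, 3, 2), (0, 2, 1, 3), (0, 2, 3, 1), (0, 3, 1, 2), (0, 3, 2, 1),
   (1, 0, 2, 3), (1, 0, 3, 2), (1, 2, 0, 3), (1, 2, 3, 0), (1, 3, 0, 2), (1, 3, 2, 0),
   (2, 0, 1, 3), (2, 0, 3, 1), (2, 1, 0, 3), (2, 1, 3, 0), (2, 3, 0, 1), (2, 3, 1, 0),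
   (3, 0, 1, 2), (3, 0, 2, 1), (3, 1, 0, 2), (3, 1, 2, 0), (3, 2, 0, 1), (3, 2, 1, 0)]

lemma perms4_eq : (Finset.univ : Finset (Equiv.Perm (Fin 4))).val.map
    (fun π => (π 0, π 1, π 2, π 3)) = (perms4 : Multiset _) := by
  decide +kernel

lemma countList : ∀ a0 a1 a2 a3 b0 b1 b2 b3 : Fin 2,
    perms4.countP (fun t => a0 = ![b0, b1, b2, b3] t.1 ∧ a1 = ![b0, b1, b2, b3] t.2.1 ∧
      a2 = ![b0, b1, b2, b3] t.2.2.1 ∧ a3 = ![b0, b1, b2, b3] t.2.2.2)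
    = if a0.val + a1.val + a2.val + a3.val = b0.val + b1.val + b2.val + b3.val then
        (b0.val + b1.val + b2.val + b3.val).factorial *
          (4 - (b0.val + b1.val + b2.val + b3.val)).factorial else 0 := by
  decide +kernel

lemma count4 (a0 a1 a2 a3 b0 b1 b2 b3 : Fin 2) :
    (Finset.univ.filter (fun π : Equiv.Perm (Fin 4) =>
      ∀ i, ![a0, a1, a2, a3] i = ![b0, b1, b2, b3] (π i))).card
    = if a0.val + a1.val + a2.val + a3.val = b0.val + b1.val + b2.val + b3.val then
        (b0.val + b1.val + b2.val + b3.val).factorial *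
          (4 - (b0.val + b1.val + b2.val + b3.val)).factorial else 0 := by
  rw [← countList, ← Multiset.coe_countP, ← perms4_eq, Multiset.countP_map]
  simp only [Finset.card, Finset.filter, Fin.forall_fin_succ]
  congr 2
  ext π
  simp

lemma prod_kdelta {k : ℕ} (u l : Fin k → Fin 2) :
    ∏ i, kdelta (u i) (l i) = if ∀ i, u i = l i then 1 else 0 := by
  simp only [kdelta]
  rw [Finset.prod_ite_zero]
  simp

/-- The nonzero values of the symmetrizer on four indices. -/
noncomputable def wt (n : ℕ) : ℂ := (n.factorial * (4 - n).factorial : ℕ) / 24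

lemma symk4 (a0 a1 a2 a3 b0 b1 b2 b3 : Fin 2) :
    symk (Fin.snoc (Fin.snoc ![a0, a1] a2) a3 : Fin 4 → Fin 2)
      (Fin.snoc (Fin.snoc ![b0, b1] b2) b3 : Fin 4 → Fin 2) =
    if a0.val + a1.val + a2.val + a3.val = b0.val + b1.val + b2.val + b3.val then
      wt (b0.val + b1.val + b2.val + b3.val) else 0 := by
  have h1 : ∀ a0 a1 a2 a3 : Fin 2, (Fin.snoc (Fin.snoc ![a0, a1] a2) a3 : Fin 4 → Fin 2)
      = ![a0, a1, a2, a3] := by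
    intro a0 a1 a2 a3
    ext i
    fin_cases i <;> rfl
  rw [h1, h1]
  unfold symk
  have h2 : ∀ π : Equiv.Perm (Fin 4),
      ∏ i, kdelta (![a0, a1, a2, a3] i) (![b0, b1, b2, b3] (π i)) =
      if ∀ i, ![a0, a1, a2, a3] i = ![b0, b1, b2, b3] (π i) then 1 else 0 := fun π =>
    prod_kdelta (![a0, a1, a2, a3]) (fun i => ![b0, b1, b2, b3] (π i))
  simp only [h2]
  rw [Finset.sum_boole, count4]
  split_ifs
  · simp only [wt]
    rw [show Nat.factorial 4 = 24 from rfl]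
    push_cast
    ring
  · simp

lemma symk2 (a0 a1 b0 b1 : Fin 2) :
    symk (Fin.snoc (Fin.snoc ![] a0) a1 : Fin 2 → Fin 2)
      (Fin.snoc (Fin.snoc ![] b0) b1 : Fin 2 → Fin 2) =
    (kdelta a0 b0 * kdelta a1 b1 + kdelta a0 b1 * kdelta a1 b0) / 2 := by
  have h1 : ∀ a0 a1 : Fin 2, (Fin.snoc (Fin.snoc ![] a0) a1 : Fin 2 → Fin 2)
      = ![a0, a1] := by
    intro a0 a1
    ext i
    fin_cases i <;> rfl
  rw [h1, h1]
  unfold symk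
  rw [Fintype.sum_equiv (Equiv.Perm.decomposeFin (n := 1)) _
    (fun p => ∏ i, kdelta (![a0, a1] i) (![b0, b1] (Equiv.Perm.decomposeFin.symm p i)))
    (fun x => by simp)]
  simp [Fintype.sum_prod_type, Fin.sum_univ_two, Fin.prod_univ_two, Nat.factorial]
  ring

lemma Pi0 (g : Idx → ℂ) (c1 c2 c3 c4 : Fin 2) :
    ∑ B : Idx, PiProj (k := 0) ![] ![] (Sum.inr (c1, c2, c3, c4)) B * g B =
      g (Sum.inr (c1, c2, c3, c4)) -
        kdelta c2 c4 / 2 * ∑ d : Fin 2, g (Sum.inr (c1, d, c3, d)) := by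
  simp only [Fintype.sum_sum_type, Fintype.sum_prod_type, PiProj, symk2, Fin.sum_univ_two]
  fin_cases c1 <;> fin_cases c2 <;> fin_cases c3 <;> fin_cases c4 <;>
    simp [kdelta, eps] <;> ring

lemma amp_eq (f : Idx → ℂ) (c1 c2 c3 c4 : Fin 2) :
    amp f (Sum.inr (c1, c2, c3, c4)) =
      (f (Sum.inr (c1, c2, c3, c4)) -
        kdelta c1 c3 / 2 * ∑ d : Fin 2, f (Sum.inr (d, c2, d, c4))) -
      kdelta c2 c4 / 2 * ∑ e : Fin 2, (f (Sum.inr (c1, e, c3, e)) -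
        kdelta c1 c3 / 2 * ∑ d : Fin 2, f (Sum.inr (d, e, d, e))) := by
  have hs : ∀ x, sharp (sharp x) = x := by rintro (x | ⟨i, j, k, l⟩) <;> rfl
  let σ : Idx ≃ Idx := ⟨sharp, sharp, hs, hs⟩
  have key : ∀ d1 d2 d3 d4 : Fin 2,
      ∑ C : Idx, PiProj (k := 0) ![] ![] (sharp (Sum.inr (d1, d2, d3, d4))) (sharp C) * f C =
      f (Sum.inr (d1, d2, d3, d4)) -
        kdelta d1 d3 / 2 * ∑ d : Fin 2, f (Sum.inr (d, d2, d, d4)) := by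
    intro d1 d2 d3 d4
    have h := Pi0 (fun C => f (sharp C)) d2 d1 d4 d3
    simp only [sharp] at h
    rw [← h]
    exact Fintype.sum_equiv σ _ _ (fun C => by
      change _ = PiProj _ _ _ (sharp C) * f (sharp (sharp C))
      rw [hs]; rfl)
  unfold amp
  simp only [mul_assoc, ← Finset.mul_sum]
  rw [Pi0 (fun B => ∑ C : Idx, PiProj (k := 0) ![] ![] (sharp B) (sharp C) * f C)]
  simp only [key]

/-- The general element with prescribed symmetric part. -/
noncomputable def wMk (F : Fin 2 → Fin 2 → ℕ → ℂ) (a b : Fin 2) : Idx → ℂ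
  | Sum.inl _ => 0
  | Sum.inr (c1, c2, c3, c4) => ∑ e : Fin 2, eps c4 e * F c1 c3 (a.val + b.val + c2.val + e.val)

lemma Pi2 (f : Fin 2 → Fin 2 → Idx → ℂ) (a b : Fin 2) (A : Idx) :
    (∑ c : Fin 2, ∑ d : Fin 2, ∑ B : Idx, PiProj ![a, b] ![c, d] A B * f c d B) =
    wMk (fun c1 c3 n => wt n * ∑ c : Fin 2, ∑ d : Fin 2, ∑ d2 : Fin 2, ∑ d4 : Fin 2, ∑ g : Fin 2,
      if c.val + d.val + d2.val + g.val = n then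
        eps d4 g * f c d (Sum.inr (c1, d2, c3, d4)) else 0) a b A := by
  rcases A with x | ⟨c1, c2, c3, c4⟩
  · simp [PiProj, wMk]
  · simp only [Fintype.sum_sum_type, Fintype.sum_prod_type, PiProj, symk4, wMk]
    obtain ⟨I, hI⟩ : ∃ I : ℕ → ℕ → ℂ, ∀ (m n : ℕ) (w : ℂ),
        (if m = n then w else 0) = w * I m n :=
      ⟨fun m n => if m = n then 1 else 0, fun m n w => by simp⟩
    simp only [hI]
    fin_cases c1 <;> fin_cases c3 <;> fin_cases c4 <;>
      simp [kdelta, eps, Fin.sum_univ_two, -mul_ite] <;> ring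

lemma wt_inv (G : ℕ → ℂ) (n : ℕ) (hn : n ≤ 4) :
    (wt n * ∑ c : Fin 2, ∑ d : Fin 2, ∑ d2 : Fin 2, ∑ d4 : Fin 2, ∑ g : Fin 2,
      if c.val + d.val + d2.val + g.val = n then
        eps d4 g * ∑ e : Fin 2, eps d4 e * G (c.val + d.val + d2.val + e.val) else 0) = G n := by
  interval_cases n <;> simp [wt, eps, Fin.sum_univ_two, Nat.factorial] <;> ring

lemma wMk_mem (φ : ℕ → ℂ) : WeylMem (wMk (fun c1 c3 n => kdelta c1 c3 * φ n)) := by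
  constructor
  · intro a b A
    rw [Pi2]
    rcases A with x | ⟨c1, c2, c3, c4⟩
    · rfl
    · simp only [wMk]
      refine Finset.sum_congr rfl (fun e _ => ?_)
      rw [wt_inv (fun n => kdelta c1 c3 * φ n) _ (by omega)]
  · intro a b A
    rcases A with x | ⟨c1, c2, c3, c4⟩
    · simp [amp, PiProj]
    · rw [amp_eq]
      simp only [wMk]
      fin_cases c1 <;> fin_cases c3 <;> fin_cases c2 <;> fin_cases c4 <;>
        simp [kdelta, eps, Fin.sum_univ_two]

/-- The complex vector space `Weyl` has dimension 5: there are 5 linearly independent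
elements of `Weyl` spanning all of `Weyl`. -/
theorem weyl_dim_five :
    ∃ v : Fin 5 → (Fin 2 → Fin 2 → Idx → ℂ),
      LinearIndependent ℂ v ∧ (∀ i, WeylMem (v i)) ∧
      ∀ f, WeylMem f → ∃ c : Fin 5 → ℂ, f = ∑ i, c i • v i := by

  refine ⟨fun i => wMk (fun c1 c3 n => kdelta c1 c3 * if n = i.val then 1 else 0), ?_,
    fun i => wMk_mem _, ?_⟩
  · rw [Fintype.linearIndependent_iff]
    intro g hg
    have ev : ∀ a b A, _ := fun a b A => congrFun (congrFun (congrFun hg a) b) A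
    have e0 := ev 0 0 (Sum.inr (0, 0, 0, 1))
    have e1 := ev 0 0 (Sum.inr (0, 0, 0, 0))
    have e2 := ev 0 0 (Sum.inr (0, 1, 0, 0))
    have e3 := ev 0 1 (Sum.inr (0, 1, 0, 0))
    have e4 := ev 1 1 (Sum.inr (0, 1, 0, 0))
    simp [wMk, Fin.sum_univ_five, kdelta, eps] at e0 e1 e2 e3 e4
    intro i
    fin_cases i <;> simp [e0, e1, e2, e3, e4]
  · rintro f ⟨h1, h2⟩
    obtain ⟨F, hF⟩ : ∃ F, ∀ a b A, f a b A = wMk F a b A :=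
      ⟨_, fun a b A => (h1 a b A).symm.trans (Pi2 f a b A)⟩
    have h3 : ∀ a b c1 c2 c3 c4, f a b (Sum.inr (c1, c2, c3, c4)) =
        kdelta c1 c3 / 2 * ∑ d : Fin 2, f a b (Sum.inr (d, c2, d, c4)) := by
      intro a b c1 c2 c3 c4
      have h := h2 a b (Sum.inr (c1, c2, c3, c4))
      rw [amp_eq] at h
      have ht : ∀ x y, ∑ e : Fin 2, f a b (Sum.inr (x, e, y, e)) = 0 := by
        intro x y
        simp [hF, wMk, eps, Fin.sum_univ_two]
      rw [Finset.sum_sub_distrib, ht, ← Finset.mul_sum, Finset.sum_comm] at h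
      simp only [ht] at h
      simp at h
      rw [Fin.sum_univ_two]
      linear_combination h
    refine ⟨fun i => (F 0 0 i + F 1 1 i) / 2, ?_⟩
    have pick : ∀ (G : ℕ → ℂ) n, n ≤ 4 →
        ∑ i : Fin 5, G i.val * (if n = i.val then 1 else 0) = G n := by
      intro G n hn
      interval_cases n <;> simp [Fin.sum_univ_five]
    funext a b A
    simp only [Finset.sum_apply, Pi.smul_apply, smul_eq_mul]
    rcases A with x | ⟨c1, c2, c3, c4⟩
    · simp [hF, wMk]
    · rw [h3]
      simp only [hF, wMk, Finset.mul_sum]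
      rw [Finset.sum_comm, Finset.sum_comm (s := (Finset.univ : Finset (Fin 5)))]
      refine Finset.sum_congr rfl (fun e _ => ?_)
      have hp := pick (fun n => (F 0 0 n + F 1 1 n) / 2)
        (a.val + b.val + c2.val + e.val) (by omega)
      trans eps c4 e * kdelta c1 c3 * ((F 0 0 (a.val + b.val + c2.val + e.val) +
        F 1 1 (a.val + b.val + c2.val + e.val)) / 2)
      · rw [Fin.sum_univ_two]; ring
      · rw [← hp, Finset.mul_sum]
        refine Finset.sum_congr rfl (fun i _ => ?_)
        ring
end

section
/- Let G satisfy (G1)–(G3) and let t^{ab} be Hermitian with conj(s_a) t^{ab} s_b > 0 for all s ≠ 0. Then (G5) holds: conj(w_{ma}^A) t^{mn} G^{ab}{}_{AB} w_{nb}^B > 0 for every nonzero w with w_{ab}^{&A} = 0 and conj(w_{ab}^A) = w_{ba}^{♯A}. -/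
theorem symk_comp {k : ℕ} (up lo : Fin k → Fin 2) (σ : Equiv.Perm (Fin k)) :
    symk up (lo ∘ σ) = symk up lo := by
  unfold symk
  congr 1
  exact Fintype.sum_equiv (Equiv.mulLeft σ) _ _ (fun π => by simp)

theorem symk_three_swap (up : Fin 3 → Fin 2) (a x y : Fin 2) :
    symk up (Fin.snoc (Fin.snoc ![a] x) y) = symk up (Fin.snoc (Fin.snoc ![a] y) x) := by
  rw [← symk_comp up (Fin.snoc (Fin.snoc ![a] y) x) (Equiv.swap 1 2)]
  congr 1
  funext i
  fin_cases i <;> rfl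

theorem symk_two (up lo : Fin 2 → Fin 2) :
    symk up lo = 2⁻¹ * (kdelta (up 0) (lo 0) * kdelta (up 1) (lo 1)
      + kdelta (up 0) (lo 1) * kdelta (up 1) (lo 0)) := by
  unfold symk
  have h : (Finset.univ : Finset (Equiv.Perm (Fin 2))) = {1, Equiv.swap 0 1} := by decide
  rw [h, Finset.sum_pair (by decide)]
  simp [Fin.prod_univ_two, Nat.factorial]

theorem PiProj_one_trace (a b c1 c3 : Fin 2) (B : Idx) :
    ∑ d : Fin 2, PiProj ![a] ![b] (Sum.inr (c1, d, c3, d)) B = 0 := by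
  rcases B with B | ⟨d1, d2, d3, d4⟩
  · simp [PiProj]
  · simp only [PiProj, Fin.sum_univ_two]
    have e0 : eps 0 0 = 0 := by simp [eps]
    have e1 : eps 1 1 = 0 := by simp [eps]
    have e2 : eps 0 1 = 1 := by simp [eps]
    have e3 : eps 1 0 = -1 := by simp [eps]
    rw [symk_three_swap _ a 0 1, symk_three_swap _ a 0 1, e0, e1, e2, e3]
    ring

theorem PiProj_zero_inr (c1 c2 c3 c4 d1 d2 d3 d4 : Fin 2) :
    PiProj (k := 0) ![] ![] (Sum.inr (c1, c2, c3, c4)) (Sum.inr (d1, d2, d3, d4)) =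
      kdelta c1 d1 * kdelta c3 d3 *
        (kdelta c2 d2 * kdelta c4 d4 - 2⁻¹ * (kdelta c2 c4 * kdelta d2 d4)) := by
  simp only [PiProj, symk_two]
  congr 1
  change ∑ e : Fin 2, ∑ f : Fin 2, eps c4 e * eps d4 f *
    (2⁻¹ * (kdelta d2 c2 * kdelta f e + kdelta d2 e * kdelta f c2)) = _
  simp only [Fin.sum_univ_two]
  fin_cases c2 <;> fin_cases c4 <;> fin_cases d2 <;> fin_cases d4 <;>
    simp [eps, kdelta] <;> norm_num

theorem PiProj_zero_fix (f : Idx → ℂ) (h0 : ∀ i, f (Sum.inl i) = 0)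
    (h1 : ∀ c1 c3, ∑ d : Fin 2, f (Sum.inr (c1, d, c3, d)) = 0) (A : Idx) :
    ∑ B : Idx, PiProj (k := 0) ![] ![] A B * f B = f A := by
  rcases A with A | ⟨c1, c2, c3, c4⟩
  · rw [h0]
    simp [PiProj]
  · have h := h1 c1 c3
    simp only [Fin.sum_univ_two] at h
    simp only [Fintype.sum_sum_type, h0, mul_zero, Finset.sum_const_zero, zero_add,
      Fintype.sum_prod_type, PiProj_zero_inr, Fin.sum_univ_two]
    fin_cases c1 <;> fin_cases c2 <;> fin_cases c3 <;> fin_cases c4 <;>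
      simp [kdelta] at h ⊢ <;> linear_combination (-(1/2) : ℂ) * h

theorem sharp_sharp (A : Idx) : sharp (sharp A) = A := by
  rcases A with A | ⟨c1, c2, c3, c4⟩ <;> rfl

theorem amp_fix (f : Idx → ℂ) (h0 : ∀ i, f (Sum.inl i) = 0)
    (h1 : ∀ c1 c3, ∑ d : Fin 2, f (Sum.inr (c1, d, c3, d)) = 0)
    (h2 : ∀ c1 c3, ∑ d : Fin 2, f (Sum.inr (d, c1, d, c3)) = 0) (A : Idx) :
    amp f A = f A := by
  have key : ∀ B, ∑ C : Idx, PiProj (k := 0) ![] ![] (sharp B) (sharp C) * f C = f B := by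
    intro B
    have h := PiProj_zero_fix (fun C => f (sharp C)) (fun i => h0 i)
      (fun c1 c3 => h2 c1 c3) (sharp B)
    rw [sharp_sharp] at h
    rw [← h]
    let e : Idx ≃ Idx := ⟨sharp, sharp, sharp_sharp, sharp_sharp⟩
    exact Fintype.sum_equiv e _ _ (fun C => by simp [e, sharp_sharp])
  unfold amp
  simp only [mul_assoc, ← Finset.mul_sum, key]
  exact PiProj_zero_fix f h0 h1 A

theorem amp_comb (f g : Idx → ℂ) (c : ℂ) (A : Idx) :
    amp (fun B => f B + c * g B) A = amp f A + c * amp g A := by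
  unfold amp
  simp only [Finset.mul_sum, ← Finset.sum_add_distrib]
  refine Finset.sum_congr rfl fun B _ => Finset.sum_congr rfl fun C _ => ?_
  ring

/-- The sesquilinear form of `G`. -/
noncomputable def Qf (G : Fin 2 → Fin 2 → Idx → Idx → ℂ) (u v : Fin 2 → Idx → ℂ) : ℂ :=
  ∑ a : Fin 2, ∑ b : Fin 2, ∑ A : Idx, ∑ B : Idx, starRingEnd ℂ (u a A) * G a b A B * v b B

theorem Qf_conj (G : Fin 2 → Fin 2 → Idx → Idx → ℂ)
    (hG1b : ∀ (a b : Fin 2) (A B : Idx), starRingEnd ℂ (G b a B A) = G a b A B)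
    (u v : Fin 2 → Idx → ℂ) : starRingEnd ℂ (Qf G u v) = Qf G v u := by
  unfold Qf
  simp only [map_sum, map_mul, Complex.conj_conj]
  rw [Finset.sum_comm]
  refine Finset.sum_congr rfl fun a _ => Finset.sum_congr rfl fun b _ => ?_
  rw [Finset.sum_comm]
  refine Finset.sum_congr rfl fun A _ => Finset.sum_congr rfl fun B _ => ?_
  rw [hG1b]
  ring

theorem Qf_comb (G : Fin 2 → Fin 2 → Idx → Idx → ℂ) (u v : Fin 2 → Idx → ℂ) (c : ℂ) :
    Qf G (fun a A => u a A + c * v a A) (fun a A => u a A + c * v a A) =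
      Qf G u u + c * Qf G u v + starRingEnd ℂ c * Qf G v u
        + starRingEnd ℂ c * c * Qf G v v := by
  unfold Qf
  simp only [Finset.mul_sum, ← Finset.sum_add_distrib]
  refine Finset.sum_congr rfl fun a _ => Finset.sum_congr rfl fun b _ =>
    Finset.sum_congr rfl fun A _ => Finset.sum_congr rfl fun B _ => ?_
  simp only [map_add, map_mul]
  ring

theorem fix_inl (v : Fin 2 → Idx → ℂ)
    (h : ∀ (a : Fin 2) (A : Idx),
          (∑ b : Fin 2, ∑ B : Idx, PiProj ![a] ![b] A B * v b B) = v a A) (a : Fin 2)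
    (i : Fin 4) : v a (Sum.inl i) = 0 := by
  rw [← h]
  simp [PiProj]

theorem fix_trace (v : Fin 2 → Idx → ℂ)
    (h : ∀ (a : Fin 2) (A : Idx),
          (∑ b : Fin 2, ∑ B : Idx, PiProj ![a] ![b] A B * v b B) = v a A) (a c1 c3 : Fin 2) :
    ∑ d : Fin 2, v a (Sum.inr (c1, d, c3, d)) = 0 := by
  simp only [← h a]
  rw [Finset.sum_comm]
  refine Finset.sum_eq_zero fun b _ => ?_
  rw [Finset.sum_comm]
  refine Finset.sum_eq_zero fun B _ => ?_
  rw [← Finset.sum_mul, PiProj_one_trace, zero_mul]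

/-- (G5): `conj(w_{ma}^A) t^{mn} G^{ab}{}_{AB} w_{nb}^B > 0` for nonzero `w` with
`w_{ab}^{&A} = 0` and `conj(w_{ab}^A) = w_{ba}^{♯A}`, given (G1)–(G3) and `t`
Hermitian positive definite. -/
theorem gauge_G5
    (G : Fin 2 → Fin 2 → Idx → Idx → ℂ)
    -- (G1): G^{ab}{}_{A&B} = 0 and conj(G^{ba}{}_{BA}) = G^{ab}{}_{AB}
    (hG1a : ∀ (a b : Fin 2) (A B : Idx),
      (∑ X : Idx, ∑ Y : Idx, G a b A X * PiProj (k := 0) ![] ![] X Y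
        * PiProj (k := 0) ![] ![] (sharp Y) (sharp B)) = 0)
    (hG1b : ∀ (a b : Fin 2) (A B : Idx), starRingEnd ℂ (G b a B A) = G a b A B)
    -- (G2): G^{ab}{}_{AB} Π_b^{Bc}{}_C = 0
    (hG2 : ∀ (a c : Fin 2) (A C : Idx),
      (∑ b : Fin 2, ∑ B : Idx, G a b A B * PiProj ![b] ![c] B C) = 0)
    -- (G3): positivity, with the stated equality case
    (hG3pos : ∀ v : Fin 2 → Idx → ℂ,
      0 ≤ (∑ a : Fin 2, ∑ b : Fin 2, ∑ A : Idx, ∑ B : Idx,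
        starRingEnd ℂ (v a A) * G a b A B * v b B).re)
    (hG3eq : ∀ v : Fin 2 → Idx → ℂ, (∀ (b : Fin 2) (B : Idx), amp (v b) B = 0) →
      ((∑ a : Fin 2, ∑ b : Fin 2, ∑ A : Idx, ∑ B : Idx,
          starRingEnd ℂ (v a A) * G a b A B * v b B) = 0 ↔
        ∀ (a : Fin 2) (A : Idx),
          (∑ b : Fin 2, ∑ B : Idx, PiProj ![a] ![b] A B * v b B) = v a A))
    -- t^{mn}: Hermitian and positive definite
    (t : Matrix (Fin 2) (Fin 2) ℂ)
    (htherm : ∀ m n : Fin 2, starRingEnd ℂ (t n m) = t m n)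
    (htpos : ∀ s : Fin 2 → ℂ, s ≠ 0 →
      0 < (∑ m : Fin 2, ∑ n : Fin 2, starRingEnd ℂ (s m) * t m n * s n).re)
    (w : Fin 2 → Fin 2 → Idx → ℂ)
    (hwamp : ∀ (a b : Fin 2) (A : Idx), amp (w a b) A = 0)
    (hw : w ≠ 0)
    (hwreal : ∀ (a b : Fin 2) (A : Idx), starRingEnd ℂ (w a b A) = w b a (sharp A)) :
    0 < ((∑ m : Fin 2, ∑ n : Fin 2, ∑ a : Fin 2, ∑ b : Fin 2, ∑ A : Idx, ∑ B : Idx,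
      starRingEnd ℂ (w m a A) * t m n * G a b A B * w n b B)).re := by
  have hsum : (∑ m : Fin 2, ∑ n : Fin 2, ∑ a : Fin 2, ∑ b : Fin 2, ∑ A : Idx, ∑ B : Idx,
      starRingEnd ℂ (w m a A) * t m n * G a b A B * w n b B)
      = ∑ m : Fin 2, ∑ n : Fin 2, t m n * Qf G (w m) (w n) := by
    unfold Qf
    simp only [Finset.mul_sum]
    refine Finset.sum_congr rfl fun m _ => Finset.sum_congr rfl fun n _ =>
      Finset.sum_congr rfl fun a _ => Finset.sum_congr rfl fun b _ =>
      Finset.sum_congr rfl fun A _ => Finset.sum_congr rfl fun B _ => ?_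
    ring
  rw [hsum]
  have him : ∀ v, (Qf G v v).im = 0 := fun v =>
    Complex.conj_eq_iff_im.mp (Qf_conj G hG1b v v)
  have ht0 : 0 < (t 0 0).re := by
    have h := htpos ![1, 0] (by intro h; simpa using congrFun h 0)
    simpa [Fin.sum_univ_two] using h
  have ht0im : (t 0 0).im = 0 := Complex.conj_eq_iff_im.mp (htherm 0 0)
  have ht0ne : t 0 0 ≠ 0 := by
    intro h
    rw [h] at ht0
    simp at ht0
  obtain ⟨c, hc⟩ : ∃ c, t 0 0 * c = t 0 1 := ⟨t 0 1 / t 0 0, by field_simp⟩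
  have hc' : t 0 0 * starRingEnd ℂ c = t 1 0 := by
    rw [← htherm 1 0, ← hc, map_mul, htherm 0 0]
  have hd := htpos ![-c, 1] (by intro h; simpa using congrFun h 1)
  simp only [Fin.sum_univ_two, Matrix.cons_val_zero, Matrix.cons_val_one, map_neg, map_one] at hd
  set d : ℂ := (-starRingEnd ℂ c * t 0 0 * -c + -starRingEnd ℂ c * t 0 1 * 1 +
    (1 * t 1 0 * -c + 1 * t 1 1 * 1)) with hdd
  set x : Fin 2 → Idx → ℂ := fun a A => w 0 a A + c * w 1 a A with hx
  have htot : ∑ m : Fin 2, ∑ n : Fin 2, t m n * Qf G (w m) (w n)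
      = t 0 0 * Qf G x x + d * Qf G (w 1) (w 1) := by
    rw [hx, Qf_comb, hdd]
    simp only [Fin.sum_univ_two]
    rw [← hc, ← hc']
    ring
  rw [htot]
  simp only [Complex.add_re, Complex.mul_re, him, mul_zero, sub_zero]
  have hp0 : 0 ≤ (Qf G x x).re := hG3pos x
  have hp1 : 0 ≤ (Qf G (w 1) (w 1)).re := hG3pos (w 1)
  by_contra hneg
  have hm0 := mul_nonneg ht0.le hp0
  have hm1 := mul_nonneg hd.le hp1
  have hz0 : (Qf G x x).re = 0 := by
    have : (t 0 0).re * (Qf G x x).re = 0 := by linarith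
    exact (mul_eq_zero.mp this).resolve_left ht0.ne'
  have hz1 : (Qf G (w 1) (w 1)).re = 0 := by
    have : d.re * (Qf G (w 1) (w 1)).re = 0 := by linarith
    exact (mul_eq_zero.mp this).resolve_left hd.ne'
  have hf1 := (hG3eq (w 1) (hwamp 1)).mp (Complex.ext hz1 (him (w 1)))
  have hfx := (hG3eq x (fun b B => by
    rw [hx]
    simp only [amp_comb, hwamp, mul_zero, add_zero])).mp (Complex.ext hz0 (him x))
  have hinl : ∀ m a i, w m a (Sum.inl i) = 0 := by
    have h1 := fix_inl _ hf1
    intro m a i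
    fin_cases m
    · have h := fix_inl _ hfx a i
      simpa [hx, h1] using h
    · exact h1 a i
  have htr : ∀ m a c1 c3, ∑ d : Fin 2, w m a (Sum.inr (c1, d, c3, d)) = 0 := by
    have h1 := fix_trace _ hf1
    intro m a c1 c3
    fin_cases m
    · have h := fix_trace _ hfx a c1 c3
      simp only [hx, Finset.sum_add_distrib, ← Finset.mul_sum, h1, mul_zero, add_zero] at h
      exact h
    · exact h1 a c1 c3
  have htr2 : ∀ m a c1 c3, ∑ d : Fin 2, w m a (Sum.inr (d, c1, d, c3)) = 0 := by
    intro m a c1 c3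
    have h := congrArg (starRingEnd ℂ) (htr a m c1 c3)
    simpa only [map_sum, hwreal, sharp, map_zero] using h
  apply hw
  funext m a A
  have h := amp_fix (w m a) (hinl m a) (htr m a) (htr2 m a) A
  rw [hwamp] at h
  exact h.symm
end
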